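/- Assume vol(V) > 0 and let p ∈ [1, ∞). Let x ∈ ℝⁿ, x ≠ 0, set r = F(x), let s ∈ ∂Q_r(x), and let y ∈ ℝⁿ be a minimizer of z ↦ r·‖z‖_∞ − ⟨z, s⟩ over {z : ‖z‖_p = 1} (that is, ‖y‖_p = 1 and r·‖y‖_∞ − ⟨y, s⟩ ≤ r·‖z‖_∞ − ⟨z, s⟩ for every z with ‖z‖_p = 1). Then F(y) ≥ F(x). -/

import Mathlib

open Finset

noncomputable section

/-- Degree `d_i = ∑_j w_{ij}`. -/
def dvec (n : ℕ) (w : Fin n → Fin n → ℝ) (i : Fin n) : ℝ := ∑ j, w i j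

/-- Volume of a vertex subset: `vol(A) = ∑_{i ∈ A} d_i`. -/
def vol (n : ℕ) (w : Fin n → Fin n → ℝ) (A : Finset (Fin n)) : ℝ := ∑ i ∈ A, dvec n w i

/-- Cut value: `cut(S) = ∑_{i ∈ S} ∑_{j ∉ S} w_{ij}`. -/
def cut (n : ℕ) (w : Fin n → Fin n → ℝ) (S : Finset (Fin n)) : ℝ := ∑ i ∈ S, ∑ j ∈ Sᶜ, w i j

/-- `I(x) = ∑_{i<j} w_{ij} |x_i - x_j|`. -/
def Ifun (n : ℕ) (w : Fin n → Fin n → ℝ) (x : Fin n → ℝ) : ℝ :=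
  ∑ i, ∑ j, if i < j then w i j * |x i - x j| else 0

/-- `N(x) = min_{c ∈ ℝ} ∑_i d_i |x_i - c|`. -/
def Nfun (n : ℕ) (d : Fin n → ℝ) (x : Fin n → ℝ) : ℝ :=
  sInf (Set.range fun c : ℝ => ∑ i, d i * |x i - c|)

/-- The anti-Cheeger objective `F(x) = I(x) / (2 vol(V) ‖x‖_∞ - N(x))`.
Note `‖x‖` on `Fin n → ℝ` is the sup norm `‖x‖_∞ = max_i |x_i|`. -/
def Ffun (n : ℕ) (w : Fin n → Fin n → ℝ) (x : Fin n → ℝ) : ℝ :=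
  Ifun n w x / (2 * vol n w univ * ‖x‖ - Nfun n (dvec n w) x)

/-- `Q_r(x) = (I(x) + r N(x)) / (2 vol(V))`. -/
def Qfun (n : ℕ) (w : Fin n → Fin n → ℝ) (r : ℝ) (x : Fin n → ℝ) : ℝ :=
  (Ifun n w x + r * Nfun n (dvec n w) x) / (2 * vol n w univ)

/-- The subdifferential of `f : ℝⁿ → ℝ` at `x`:
all `s` with `f y ≥ f x + ⟨s, y - x⟩` for all `y`. -/
def subgrad (n : ℕ) (f : (Fin n → ℝ) → ℝ) (x : Fin n → ℝ) : Set (Fin n → ℝ) :=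
  {s | ∀ y, f y ≥ f x + ∑ i, s i * (y i - x i)}

/-- `‖x‖_p = (∑_i |x_i|^p)^{1/p}`. -/
def pnorm (n : ℕ) (p : ℝ) (x : Fin n → ℝ) : ℝ := (∑ i, |x i| ^ p) ^ (1 / p)

lemma dvec_nonneg {n : ℕ} {w : Fin n → Fin n → ℝ} (hw : ∀ i j, 0 ≤ w i j) (i : Fin n) :
    0 ≤ dvec n w i :=
  sum_nonneg fun j _ => hw i j

lemma Nfun_le {n : ℕ} {d : Fin n → ℝ} (hd : ∀ i, 0 ≤ d i) (x : Fin n → ℝ) (c : ℝ) :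
    Nfun n d x ≤ ∑ i, d i * |x i - c| := by
  refine csInf_le ⟨0, ?_⟩ ⟨c, rfl⟩
  rintro _ ⟨b, rfl⟩
  exact sum_nonneg fun i _ => mul_nonneg (hd i) (abs_nonneg _)

lemma Nfun_smul_le {n : ℕ} {d : Fin n → ℝ} (hd : ∀ i, 0 ≤ d i) (x : Fin n → ℝ) {t : ℝ}
    (ht : 0 < t) : Nfun n d (t • x) ≤ t * Nfun n d x := by
  rw [← div_le_iff₀' ht]
  refine le_csInf (Set.range_nonempty _) ?_
  rintro _ ⟨c, rfl⟩
  rw [div_le_iff₀' ht]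
  refine (Nfun_le hd _ (t * c)).trans_eq ?_
  simp only [mul_sum]
  refine sum_congr rfl fun i _ => ?_
  rw [Pi.smul_apply, smul_eq_mul, ← mul_sub, abs_mul, abs_of_pos ht]
  ring

lemma Ifun_nonneg {n : ℕ} {w : Fin n → Fin n → ℝ} (hw : ∀ i j, 0 ≤ w i j) (x : Fin n → ℝ) :
    0 ≤ Ifun n w x := by
  refine sum_nonneg fun i _ => sum_nonneg fun j _ => ?_
  split_ifs
  · exact mul_nonneg (hw i j) (abs_nonneg _)
  · exact le_rfl

lemma Ifun_smul {n : ℕ} (w : Fin n → Fin n → ℝ) (x : Fin n → ℝ) {t : ℝ} (ht : 0 ≤ t) :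
    Ifun n w (t • x) = t * Ifun n w x := by
  simp only [Ifun, mul_sum]
  refine sum_congr rfl fun i _ => sum_congr rfl fun j _ => ?_
  split_ifs
  · rw [Pi.smul_apply, Pi.smul_apply, smul_eq_mul, smul_eq_mul, ← mul_sub, abs_mul,
      abs_of_nonneg ht]
    ring
  · rw [mul_zero]

lemma Ffun_denom_pos {n : ℕ} {w : Fin n → Fin n → ℝ} (hw : ∀ i j, 0 ≤ w i j)
    (hvol : 0 < vol n w univ) {x : Fin n → ℝ} (hx : x ≠ 0) :
    0 < 2 * vol n w univ * ‖x‖ - Nfun n (dvec n w) x := by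
  have hN : Nfun n (dvec n w) x ≤ vol n w univ * ‖x‖ := by
    refine (Nfun_le (dvec_nonneg hw) x 0).trans ?_
    rw [vol, sum_mul]
    refine sum_le_sum fun i _ => mul_le_mul_of_nonneg_left ?_ (dvec_nonneg hw i)
    simpa using norm_le_pi_norm x i
  have := mul_pos hvol (norm_pos_iff.mpr hx)
  linarith

lemma Qfun_zero_nonpos {n : ℕ} {w : Fin n → Fin n → ℝ} (hw : ∀ i j, 0 ≤ w i j)
    (hvol : 0 < vol n w univ) {r : ℝ} (hr : 0 ≤ r) : Qfun n w r 0 ≤ 0 := by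
  have hI : Ifun n w 0 = 0 := by simp [Ifun]
  have hN : Nfun n (dvec n w) 0 ≤ 0 := by
    simpa using Nfun_le (dvec_nonneg hw) 0 0
  rw [Qfun, hI, zero_add]
  exact div_nonpos_of_nonpos_of_nonneg (mul_nonpos_of_nonneg_of_nonpos hr hN) (by positivity)

lemma Qfun_smul_le {n : ℕ} {w : Fin n → Fin n → ℝ} (hw : ∀ i j, 0 ≤ w i j)
    (hvol : 0 < vol n w univ) {r : ℝ} (hr : 0 ≤ r) (x : Fin n → ℝ) {t : ℝ} (ht : 0 < t) :
    Qfun n w r (t • x) ≤ t * Qfun n w r x := by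
  rw [Qfun, Qfun, ← mul_div_assoc, Ifun_smul w x ht.le]
  refine div_le_div_of_nonneg_right ?_ (by positivity)
  have := mul_le_mul_of_nonneg_left (Nfun_smul_le (dvec_nonneg hw) x ht) hr
  linarith

/-- The Euler identity for subgradients of the positively homogeneous function `Q_r`. -/
lemma sum_mul_eq_Qfun_of_mem_subgrad {n : ℕ} {w : Fin n → Fin n → ℝ} (hw : ∀ i j, 0 ≤ w i j)
    (hvol : 0 < vol n w univ) {r : ℝ} (hr : 0 ≤ r) {x s : Fin n → ℝ}
    (hs : s ∈ subgrad n (Qfun n w r) x) : ∑ i, s i * x i = Qfun n w r x := by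
  have h0 := hs 0
  have h2 := hs ((2 : ℝ) • x)
  have e0 : ∑ i, s i * ((0 : Fin n → ℝ) i - x i) = -∑ i, s i * x i := by simp
  have e2 : ∑ i, s i * (((2 : ℝ) • x) i - x i) = ∑ i, s i * x i := by
    refine sum_congr rfl fun i _ => ?_
    rw [Pi.smul_apply, smul_eq_mul]
    ring
  rw [e0] at h0
  rw [e2] at h2
  linarith [Qfun_zero_nonpos hw hvol hr, Qfun_smul_le hw hvol hr x two_pos]

lemma pnorm_zero {n : ℕ} {p : ℝ} (hp : 0 < p) : pnorm n p 0 = 0 := by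
  simp [pnorm, Real.zero_rpow hp.ne', hp.ne']

lemma pnorm_pos {n : ℕ} {p : ℝ} {x : Fin n → ℝ} (hx : x ≠ 0) : 0 < pnorm n p x := by
  obtain ⟨i, hi⟩ := Function.ne_iff.mp hx
  refine Real.rpow_pos_of_pos (sum_pos' (fun j _ => by positivity) ⟨i, mem_univ i, ?_⟩) _
  exact Real.rpow_pos_of_pos (abs_pos.mpr hi) p

lemma pnorm_smul {n : ℕ} {p : ℝ} (hp : 0 < p) (x : Fin n → ℝ) {t : ℝ} (ht : 0 ≤ t) :
    pnorm n p (t • x) = t * pnorm n p x := by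
  have h : ∑ i, |(t • x) i| ^ p = t ^ p * ∑ i, |x i| ^ p := by
    rw [mul_sum]
    refine sum_congr rfl fun i _ => ?_
    rw [Pi.smul_apply, smul_eq_mul, abs_mul, abs_of_nonneg ht, Real.mul_rpow ht (abs_nonneg _)]
  rw [pnorm, pnorm, h, Real.mul_rpow (by positivity) (sum_nonneg fun i _ => by positivity),
    ← Real.rpow_mul ht, mul_one_div_cancel hp.ne', Real.rpow_one]

/-- a minimizer `y` of `z ↦ r‖z‖_∞ - ⟨z, s⟩` on the unit `p`-sphere,
with `r = F(x)` and `s ∈ ∂Q_r(x)`, satisfies `F(y) ≥ F(x)`. -/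
theorem stmt12 (n : ℕ) (hn : 1 ≤ n) (w : Fin n → Fin n → ℝ)
    (hsymm : ∀ i j, w i j = w j i) (hnn : ∀ i j, 0 ≤ w i j)
    (hdiag : ∀ i, w i i = 0) (hvol : 0 < vol n w univ)
    (p : ℝ) (hp : 1 ≤ p)
    (x : Fin n → ℝ) (hx : x ≠ 0)
    (r : ℝ) (hr : r = Ffun n w x)
    (s : Fin n → ℝ) (hs : s ∈ subgrad n (Qfun n w r) x)
    (y : Fin n → ℝ) (hy : pnorm n p y = 1)
    (hmin : ∀ z : Fin n → ℝ, pnorm n p z = 1 →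
      r * ‖y‖ - (∑ i, y i * s i) ≤ r * ‖z‖ - ∑ i, z i * s i) :
    Ffun n w y ≥ Ffun n w x := by
  have hp0 : 0 < p := by linarith
  have hDx := Ffun_denom_pos hnn hvol hx
  have hy0 : y ≠ 0 := by
    rintro rfl
    rw [pnorm_zero hp0] at hy
    exact zero_ne_one hy
  have hr0 : 0 ≤ r := hr ▸ div_nonneg (Ifun_nonneg hnn x) hDx.le
  have hsx := sum_mul_eq_Qfun_of_mem_subgrad hnn hvol hr0 hs
  have hQx : Qfun n w r x = r * ‖x‖ := by
    rw [Ffun, eq_div_iff hDx.ne'] at hr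
    rw [Qfun, div_eq_iff (by positivity)]
    linarith
  have hQy : ∑ i, y i * s i ≤ Qfun n w r y := by
    have h := hs y
    simp only [mul_sub, sum_sub_distrib, hsx] at h
    simp only [mul_comm (y _)]
    linarith
  have hyle : r * ‖y‖ ≤ ∑ i, y i * s i := by
    have ht := inv_pos.mpr (pnorm_pos (p := p) hx)
    set t := (pnorm n p x)⁻¹
    have h := hmin (t • x) (by
      rw [pnorm_smul hp0 x ht.le]
      exact inv_mul_cancel₀ (pnorm_pos hx).ne')
    have e : ∑ i, (t • x) i * s i = t * (r * ‖x‖) := by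
      rw [← hQx, ← hsx, mul_sum]
      refine sum_congr rfl fun i _ => ?_
      rw [Pi.smul_apply, smul_eq_mul]
      ring
    rw [e, norm_smul, Real.norm_of_nonneg ht.le] at h
    linarith
  have h := hyle.trans hQy
  rw [Qfun, le_div_iff₀ (by positivity)] at h
  rw [← hr, ge_iff_le, Ffun, le_div_iff₀ (Ffun_denom_pos hnn hvol hy0)]
  linarith
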